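/- arXiv:1609.04099 — 10 statements merged into one kernel-verified Lean document; each statement's English description precedes it below -/
import Mathlib

section
/- In a finite sequential game, if s ⇀ᶜ_a s₀ ⇀ᶜ s₁ ⇀ᶜ … ⇀ᶜ s_n ⇀ᶜ_b s' is a chain of lazy conversion steps such that s and s' induce the same play, and this play is different from each of the plays induced by s₀, …, s_n, then a = b. -/
/-- A finite sequential game: a finite rooted tree whose internal vertices are owned by
players and whose leaves carry outcomes. -/
inductive GameTree (A O : Type) : Type where
  | leaf : O → GameTree A O
  | node : A → (n : ℕ) → (Fin (n+1) → GameTree A O) → GameTree A O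

/-- A strategy profile of a finite sequential game: the game tree together with
one chosen child at each internal vertex. -/
inductive Profile (A O : Type) : Type where
  | leaf : O → Profile A O
  | node : A → (n : ℕ) → (Fin (n+1) → Profile A O) → Fin (n+1) → Profile A O

namespace Profile

/-- The outcome induced by a strategy profile. -/
def outcome {A O : Type} : Profile A O → O
  | leaf o => o
  | node _ _ c i => outcome (c i)

/-- The play (maximal path from the root, given by the indices of the chosen children)
induced by a strategy profile. -/
def play {A O : Type} : Profile A O → List ℕ
  | leaf _ => []
  | node _ _ c i => i.1 :: play (c i)

/-- The game underlying a strategy profile. -/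
def s2g {A O : Type} : Profile A O → GameTree A O
  | leaf o => .leaf o
  | node p n c _ => .node p n (fun j => s2g (c j))

/-- Player `a` can lazily convert `s` into `s'` (`s ⇀ᶜ_a s'`): every vertex at which `s`
and `s'` differ is owned by `a` and lies on the play induced by `s'`. -/
inductive LazyConv {A O : Type} (a : A) : Profile A O → Profile A O → Prop where
  | leaf (o : O) : LazyConv a (.leaf o) (.leaf o)
  | node (p : A) (n : ℕ) (c c' : Fin (n+1) → Profile A O) (i i' : Fin (n+1)) :
      (i ≠ i' → p = a) →
      (∀ j, j ≠ i' → c j = c' j) →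
      LazyConv a (c i') (c' i') →
      LazyConv a (.node p n c i) (.node p n c' i')

/-- Player `a` can convert `s` into `s'` (`s ↠ᶜ_a s'`): every vertex at which `s` and
`s'` differ is owned by `a`. -/
inductive Conv {A O : Type} (a : A) : Profile A O → Profile A O → Prop where
  | leaf (o : O) : Conv a (.leaf o) (.leaf o)
  | node (p : A) (n : ℕ) (c c' : Fin (n+1) → Profile A O) (i i' : Fin (n+1)) :
      (i ≠ i' → p = a) →
      (∀ j, Conv a (c j) (c' j)) →
      Conv a (.node p n c i) (.node p n c' i')

/-- The lazy improvement relation of player `a` (`⇀_a`). -/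
def LazyImp {A O : Type} (prec : A → O → O → Prop) (a : A) (s s' : Profile A O) : Prop :=
  LazyConv a s s' ∧ prec a s.outcome s'.outcome

/-- The collective lazy improvement relation (`⇀`). -/
def Lazy {A O : Type} (prec : A → O → O → Prop) (s s' : Profile A O) : Prop :=
  ∃ a, LazyImp prec a s s'

/-- The improvement relation of player `a` (`↠_a`). -/
def Imp {A O : Type} (prec : A → O → O → Prop) (a : A) (s s' : Profile A O) : Prop :=
  Conv a s s' ∧ prec a s.outcome s'.outcome

/-- The collective improvement relation (`↠`). -/
def Improve {A O : Type} (prec : A → O → O → Prop) (s s' : Profile A O) : Prop :=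
  ∃ a, Imp prec a s s'

end Profile

/-- A relation is acyclic if it admits no finite cycle `x₀ ≺ x₁ ≺ … ≺ x_k ≺ x₀`. -/
def Acyclic {X : Type*} (r : X → X → Prop) : Prop :=
  ∀ x, ¬ Relation.TransGen r x x

namespace Profile

/-- The deepest vertex on the path `π` at which `s` deviates from `π` is owned by `a`. -/
inductive Dev {A O : Type} (a : A) : List ℕ → Profile A O → Prop where
  | deep (p : A) (n : ℕ) (c : Fin (n+1) → Profile A O) (i k : Fin (n+1)) (π : List ℕ) :
      Dev a π (c k) → Dev a (k.1 :: π) (.node p n c i)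
  | here (n : ℕ) (c : Fin (n+1) → Profile A O) (i k : Fin (n+1)) (π : List ℕ) :
      i ≠ k → play (c k) = π → Dev a (k.1 :: π) (.node a n c i)

theorem dev_start {A O : Type} {a : A} {s t : Profile A O} (h : LazyConv a s t) :
    play t ≠ play s → Dev a (play s) t := by
  induction h with
  | leaf o => intro h; exact absurd rfl h
  | node p n c c' i i' h1 h2 h3 ih =>
    intro hne
    by_cases hi : i = i'
    · subst hi
      exact Dev.deep _ _ _ _ _ _ (ih (fun e => hne (by simp [play, e])))
    · obtain rfl := h1 hi
      exact Dev.here _ _ _ _ _ (Ne.symm hi) (by rw [h2 i hi])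

theorem dev_step {A O : Type} {a b : A} {π : List ℕ} {s t : Profile A O} (h : Dev a π s) :
    LazyConv b s t → play t ≠ π → Dev a π t := by
  induction h generalizing t with
  | deep p n c i k π hd ih =>
    intro hc hne
    cases hc with
    | node _ _ _ c' _ i' h1 h2 h3 =>
      apply Dev.deep
      by_cases hk : k = i'
      · subst hk
        exact ih h3 (fun e => hne (by simp [play, e]))
      · rw [← h2 k hk]; exact hd
  | here n c i k π hik hp =>
    intro hc hne
    cases hc with
    | node _ _ _ c' _ i' h1 h2 h3 =>
      by_cases hk : k = i'
      · subst hk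
        obtain rfl := h1 hik
        apply Dev.deep
        subst hp
        exact dev_start h3 (fun e => hne (by simp [play, e]))
      · exact Dev.here _ _ _ _ _ (Ne.symm hk) (by rw [← h2 k hk]; exact hp)

theorem dev_end {A O : Type} {a b : A} {π : List ℕ} {s t : Profile A O} (h : Dev a π s) :
    LazyConv b s t → play t = π → a = b := by
  induction h generalizing t with
  | deep p n c i k π hd ih =>
    intro hc he
    cases hc with
    | node _ _ _ c' _ i' h1 h2 h3 =>
      simp only [play, List.cons.injEq] at he
      obtain rfl := Fin.ext he.1
      exact ih h3 he.2
  | here n c i k π hik hp =>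
    intro hc he
    cases hc with
    | node _ _ _ c' _ i' h1 h2 h3 =>
      simp only [play, List.cons.injEq] at he
      obtain rfl := Fin.ext he.1
      exact h1 hik

end Profile

open Profile in
/-- If `s ⇀ᶜ_a s₀ ⇀ᶜ s₁ ⇀ᶜ … ⇀ᶜ s_n ⇀ᶜ_b s'` is a chain of lazy conversion steps such
that `s` and `s'` induce the same play, and this play differs from each of the plays
induced by `s₀, …, s_n`, then `a = b`. -/
theorem lazyConv_avoid_play {A O : Type} (a b : A) (n : ℕ)
    (s s' : Profile A O) (f : ℕ → Profile A O)
    (h0 : LazyConv a s (f 0))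
    (hmid : ∀ i, i < n → ∃ c : A, LazyConv c (f i) (f (i+1)))
    (hlast : LazyConv b (f n) s')
    (hplay : play s = play s')
    (hdiff : ∀ i, i ≤ n → play (f i) ≠ play s) :
    a = b := by
  have key : ∀ i, i ≤ n → Dev a (play s) (f i) := by
    intro i
    induction i with
    | zero => intro hi; exact dev_start h0 (hdiff 0 hi)
    | succ i ih =>
      intro hi
      obtain ⟨c, hc⟩ := hmid i hi
      exact dev_step (ih (Nat.le_of_succ_le hi)) hc (hdiff _ hi)
  exact dev_end (key n le_rfl) hlast hplay.symm
end

section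
/- In a finite sequential game, if s ↠ s' (some player can convert s to s' by an improvement step), then there exists a strategy profile s'' such that s ⇀ s'' (a lazy improvement step) and v(s') = v(s''). -/
theorem Profile.exists_lazyConv_of_conv {A O : Type} {a : A} {s s' : Profile A O}
    (h : Profile.Conv a s s') :
    ∃ s'' : Profile A O, Profile.LazyConv a s s'' ∧ s'.outcome = s''.outcome := by
  induction h with
  | leaf o => exact ⟨_, .leaf o, rfl⟩
  | node p n c c' i i' hp _ ih =>
    obtain ⟨t, ht, ho⟩ := ih i'
    refine ⟨.node p n (Function.update c i' t) i', .node p n _ _ _ _ hp ?_ ?_, ?_⟩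
    · intro j hj
      simp [Function.update_of_ne hj]
    · simpa using ht
    · simpa [Profile.outcome] using ho

open Profile in
/-- If `s ↠ s'` (some player can convert `s` to `s'` by an improvement step), then there
is a profile `s''` with `s ⇀ s''` (a lazy improvement step) and `v(s') = v(s'')`. -/
theorem lazy_improvement_realizes_outcomes {A O : Type}
    (prec : A → O → O → Prop) (s s' : Profile A O)
    (h : Improve prec s s') :
    ∃ s'' : Profile A O, Lazy prec s s'' ∧ outcome s' = outcome s'' := by
  obtain ⟨a, hc, hp⟩ := h
  obtain ⟨t, ht, ho⟩ := exists_lazyConv_of_conv hc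
  exact ⟨t, ⟨a, ht, ho ▸ hp⟩, ho⟩
end

section
/- In a finite sequential game, the Nash equilibria are exactly the terminal profiles of the lazy improvement relation ⇀, i.e. a strategy profile s is a Nash equilibrium if and only if there is no s' with s ⇀ s'. -/
theorem conv_refl_aux {A O : Type} (a : A) (s : Profile A O) : Profile.Conv a s s := by
  induction s with
  | leaf o => exact .leaf o
  | node p n c i ih => exact .node p n c c i i (fun h => absurd rfl h) ih

theorem lazyConv_conv_aux {A O : Type} {a : A} {s t : Profile A O}
    (h : Profile.LazyConv a s t) : Profile.Conv a s t := by
  induction h with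
  | leaf o => exact .leaf o
  | node p n c c' i i' hp hc _ ih =>
    refine .node p n c c' i i' hp (fun j => ?_)
    by_cases hj : j = i'
    · subst hj
      exact ih
    · rw [hc j hj]
      exact conv_refl_aux a _

theorem conv_lazyConv_aux {A O : Type} {a : A} {s t : Profile A O}
    (h : Profile.Conv a s t) :
    ∃ u, Profile.LazyConv a s u ∧ u.outcome = t.outcome := by
  induction h with
  | leaf o => exact ⟨_, .leaf o, rfl⟩
  | node p n c c' i i' hp _ ih =>
    obtain ⟨u, hu, ho⟩ := ih i'
    refine ⟨.node p n (Function.update c i' u) i', .node p n _ _ _ _ hp ?_ ?_, ?_⟩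
    · intro j hj
      rw [Function.update_of_ne hj]
    · rw [Function.update_self]
      exact hu
    · simp only [Profile.outcome, Function.update_self]
      exact ho

open Profile in
/-- The Nash equilibria of a finite sequential game are exactly the terminal profiles of
the lazy improvement relation `⇀`: no player can profitably deviate (by changing only her
own strategy) iff no lazy improvement step is possible. -/
theorem nashEq_iff_lazy_terminal {A O : Type}
    (prec : A → O → O → Prop) (s : Profile A O) :
    (∀ a : A, ∀ s' : Profile A O, ¬ (Conv a s s' ∧ prec a s.outcome s'.outcome))
      ↔ ∀ s' : Profile A O, ¬ Lazy prec s s' := by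
  constructor
  · rintro h s' ⟨a, hc, hp⟩
    exact h a s' ⟨lazyConv_conv_aux hc, hp⟩
  · rintro h a s' ⟨hc, hp⟩
    obtain ⟨u, hu, ho⟩ := conv_lazyConv_aux hc
    exact h u ⟨a, hu, ho ▸ hp⟩
end

section
/- Consider a finite sequential game and an infinite sequence of strategy profiles (s_n)_{n∈ℕ} such that s_n ⇀ s_{n+1} for all n ∈ ℕ. If for some player a there are infinitely many n with s_n ⇀_a s_{n+1}, then the preference relation ≺_a of player a is cyclic (admits a cycle x₀ ≺_a x₁ ≺_a … ≺_a x_k ≺_a x₀). -/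
namespace Profile

/-- The set of outcomes on the leaves. -/
def leaves {A O : Type} : Profile A O → Set O
  | leaf o => {o}
  | node _ _ c _ => ⋃ j, leaves (c j)

theorem leaves_finite {A O : Type} (s : Profile A O) : s.leaves.Finite := by
  induction s with
  | leaf o => exact Set.finite_singleton o
  | node p n c i ih => exact Set.finite_iUnion ih

theorem outcome_mem {A O : Type} (s : Profile A O) : s.outcome ∈ s.leaves := by
  induction s with
  | leaf o => exact rfl
  | node p n c i ih => exact Set.mem_iUnion.2 ⟨i, ih i⟩

theorem LazyConv.leaves_eq {A O : Type} {a : A} {s s' : Profile A O} (h : LazyConv a s s') :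
    s.leaves = s'.leaves := by
  induction h with
  | leaf o => rfl
  | node p n c c' i i' h1 h2 h3 ih =>
    simp only [leaves]
    refine Set.iUnion_congr fun j => ?_
    by_cases hj : j = i'
    · subst hj; exact ih
    · rw [h2 j hj]

open Classical in
/-- Semi-potential of player `a`: total rank of the outcomes induced below the edges that are
not chosen by `a`. -/
noncomputable def pot {A O : Type} (r : O → ℕ) (a : A) : Profile A O → ℕ
  | leaf _ => 0
  | node p _ c i => ∑ j, (pot r a (c j) + if p = a ∧ j ≠ i then r (outcome (c j)) else 0)

theorem LazyConv.pot_other {A O : Type} (r : O → ℕ) {a b : A} (hab : b ≠ a)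
    {s s' : Profile A O} (h : LazyConv b s s') : pot r a s = pot r a s' := by
  induction h with
  | leaf o => rfl
  | node p n c c' i i' h1 h2 h3 ih =>
    simp only [pot]
    refine Finset.sum_congr rfl fun j _ => ?_
    by_cases hj : j = i'
    · subst hj
      rw [ih]
      by_cases hp : p = a
      · have : i = j := by
          by_contra hne
          exact hab ((h1 hne).symm.trans hp)
        simp [this]
      · simp [hp]
    · rw [h2 j hj]
      by_cases hp : p = a
      · have : i = i' := by
          by_contra hne
          exact hab ((h1 hne).symm.trans hp)
        subst this
        rfl
      · simp [hp]

open Classical in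
theorem pot_node_self {A O : Type} (r : O → ℕ) (a : A) (n : ℕ) (c : Fin (n+1) → Profile A O)
    (i : Fin (n+1)) : pot r a (node a n c i) + r (node a n c i).outcome =
      ∑ j, (pot r a (c j) + r (c j).outcome) := by
  rw [pot, outcome]
  rw [← Finset.add_sum_erase _ _ (Finset.mem_univ i),
    ← Finset.add_sum_erase (a := i) Finset.univ (fun j => pot r a (c j) + r (c j).outcome)
      (Finset.mem_univ i)]
  have : ∑ x ∈ Finset.univ.erase i, (pot r a (c x) +
      if a = a ∧ x ≠ i then r (c x).outcome else 0) =
      ∑ x ∈ Finset.univ.erase i, (pot r a (c x) + r (c x).outcome) := by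
    refine Finset.sum_congr rfl fun j hj => ?_
    simp [Finset.ne_of_mem_erase hj]
  rw [this]
  simp
  omega

theorem LazyConv.pot_self {A O : Type} (r : O → ℕ) {a : A}
    {s s' : Profile A O} (h : LazyConv a s s') :
    pot r a s + r s.outcome = pot r a s' + r s'.outcome := by
  induction h with
  | leaf o => rfl
  | node p n c c' i i' h1 h2 h3 ih =>
    by_cases hp : p = a
    · subst hp
      rw [pot_node_self, pot_node_self]
      refine Finset.sum_congr rfl fun j _ => ?_
      by_cases hj : j = i'
      · subst hj; exact ih
      · rw [h2 j hj]
    · have hi : i = i' := by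
        by_contra hne
        exact hp (h1 hne)
      subst hi
      simp only [pot, outcome, hp, false_and, if_false, add_zero]
      rw [← Finset.add_sum_erase _ _ (Finset.mem_univ i),
        ← Finset.add_sum_erase (a := i) Finset.univ (fun j => pot r a (c' j)) (Finset.mem_univ i)]
      have : ∑ x ∈ Finset.univ.erase i, pot r a (c x) =
          ∑ x ∈ Finset.univ.erase i, pot r a (c' x) := by
        refine Finset.sum_congr rfl fun j hj => ?_
        rw [h2 j (Finset.ne_of_mem_erase hj)]
      omega

end Profile

open Profile in
/-- If `(s_n)` is an infinite sequence of lazy improvement steps in a finite sequential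
game, and player `a` performs infinitely many of those steps, then `a`'s preference
relation is cyclic. -/
theorem cyclic_of_infinitely_many_lazy_steps {A O : Type}
    (prec : A → O → O → Prop) (f : ℕ → Profile A O)
    (hstep : ∀ n : ℕ, Lazy prec (f n) (f (n+1)))
    (a : A)
    (hinf : ∀ N : ℕ, ∃ n, N ≤ n ∧ LazyImp prec a (f n) (f (n+1))) :
    ∃ x : O, Relation.TransGen (prec a) x x := by
  by_contra hac
  push Not at hac
  have hl : ∀ n, (f n).leaves = (f 0).leaves := by
    intro n
    induction n with
    | zero => rfl
    | succ n ih =>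
      obtain ⟨b, hb, _⟩ := hstep n
      rw [← hb.leaves_eq, ih]
  have hmem : ∀ n, (f n).outcome ∈ (f 0).leaves := fun n => hl n ▸ outcome_mem (f n)
  let r : O → ℕ := fun x => ((f 0).leaves ∩ {z | Relation.TransGen (prec a) z x}).ncard
  have hr : ∀ x y, x ∈ (f 0).leaves → prec a x y → r x < r y := by
    intro x y hx hxy
    refine Set.ncard_lt_ncard ?_ ((leaves_finite (f 0)).inter_of_left _)
    refine ⟨fun z hz => ⟨hz.1, Relation.TransGen.tail hz.2 hxy⟩, fun hsub => ?_⟩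
    exact hac x (hsub ⟨hx, Relation.TransGen.single hxy⟩).2
  have hlt : ∀ n, LazyImp prec a (f n) (f (n+1)) → pot r a (f (n+1)) < pot r a (f n) := by
    rintro n ⟨h1, h2⟩
    have := h1.pot_self r
    have := hr _ _ (hmem n) h2
    omega
  have hanti : Antitone fun n => pot r a (f n) := by
    refine antitone_nat_of_succ_le fun n => ?_
    obtain ⟨b, hb⟩ := hstep n
    by_cases hba : b = a
    · subst hba; exact (hlt n hb).le
    · exact (hb.1.pot_other r hba).ge
  have key : ∀ k N, pot r a (f N) = k → False := by
    intro k
    induction k using Nat.strong_induction_on with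
    | _ k ih =>
      intro N hN
      obtain ⟨n, hn, h⟩ := hinf N
      have h1 := hlt n h
      have h2 : pot r a (f n) ≤ pot r a (f N) := hanti hn
      exact ih _ (by omega) (n+1) rfl
  exact key _ 0 rfl
end

section
/- Fix a set O of outcomes, a set A of players, and preference relations (≺_a)_{a∈A} on O. Then all the relations ≺_a are acyclic if and only if for every finite sequential game built from O, A and (≺_a)_{a∈A}, the collective lazy improvement relation ⇀ terminates (admits no infinite sequence s₀ ⇀ s₁ ⇀ s₂ ⇀ …). -/
namespace Profile

/-- Owner of the deepest vertex on the path at which the profile deviates from it. -/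
def dev {A O : Type} : Profile A O → List ℕ → Option A
  | leaf _, _ => none
  | node _ _ _ _, [] => none
  | node p n c i, h :: t =>
    if hh : h < n + 1 then
      match dev (c ⟨h, hh⟩) t with
      | some q => some q
      | none => if i = ⟨h, hh⟩ then none else some p
    else none

theorem dev_step_s5 {A O : Type} {b : A} {s s' : Profile A O} (hs : LazyConv b s s') :
    ∀ π : List ℕ, dev s' π = dev s π ∨ (dev s π = none ∧ dev s' π = some b) ∨
      (dev s π = some b ∧ dev s' π = none) := by
  induction hs with
  | leaf o => intro π; left; rfl
  | node p n c c' i i' h1 h2 _ ih =>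
    intro π
    cases π with
    | nil => left; rfl
    | cons h t =>
      by_cases hh : h < n + 1
      · simp only [dev, hh, dif_pos]
        by_cases e : (⟨h, hh⟩ : Fin (n+1)) = i'
        · subst e
          have := ih t
          by_cases e2 : i = ⟨h, hh⟩
          · simp only [e2, if_true]
            rcases hd : dev (c ⟨h, hh⟩) t with _ | q <;>
            rcases hd' : dev (c' ⟨h, hh⟩) t with _ | q' <;> simp_all
          · have := h1 e2
            rcases hd : dev (c ⟨h, hh⟩) t with _ | q <;>
            rcases hd' : dev (c' ⟨h, hh⟩) t with _ | q' <;> simp_all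
        · rw [← h2 _ e]
          rcases hd : dev (c ⟨h, hh⟩) t with _ | q
          · have e' : ¬ i' = ⟨h, hh⟩ := fun x => e x.symm
            simp only [e', if_false]
            by_cases e2 : i = ⟨h, hh⟩
            · have := h1 (by rw [e2]; exact e)
              simp [e2, this]
            · simp [e2]
          · simp
      · left; simp [dev, hh]

theorem dev_self {A O : Type} (s : Profile A O) : dev s (play s) = none := by
  induction s with
  | leaf o => rfl
  | node p n c i ih =>
    have := ih i
    simp [play, dev, this]

theorem dev_none {A O : Type} (s : Profile A O) :
    ∀ s' : Profile A O, s2g s' = s2g s → dev s' (play s) = none → outcome s' = outcome s := by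
  induction s with
  | leaf o =>
    intro s' h _
    cases s' with
    | leaf o' => simpa [s2g, outcome] using h
    | node => simp [s2g] at h
  | node p n c i ih =>
    intro s' h hd
    cases s' with
    | leaf o' => simp [s2g] at h
    | node p' n' c' i' =>
      simp only [s2g, GameTree.node.injEq] at h
      obtain ⟨rfl, rfl, h⟩ := h
      have h := eq_of_heq h
      simp only [play, dev, i.2, dif_pos] at hd
      rcases hd' : dev (c' i) (play (c i)) with _ | q
      · simp only [Fin.eta, hd'] at hd
        by_cases e : i' = i
        · subst e
          exact ih i' (c' i') (congrFun h i') hd'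
        · simp [e] at hd
      · simp [hd'] at hd

theorem LazyConv.s2g_eq {A O : Type} {b : A} {s s' : Profile A O} (hs : LazyConv b s s') :
    s2g s' = s2g s := by
  induction hs with
  | leaf o => rfl
  | node p n c c' i i' h1 h2 _ ih =>
    simp only [s2g, GameTree.node.injEq, heq_eq_eq, true_and]
    funext j
    by_cases e : j = i'
    · subst e; exact ih
    · rw [h2 j e]

theorem finite_s2g {A O : Type} (g : GameTree A O) : {s : Profile A O | s2g s = g}.Finite := by
  induction g with
  | leaf o =>
    refine (Set.finite_singleton (leaf o)).subset ?_
    intro s h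
    cases s <;> simp_all [s2g]
  | node p n c ih =>
    have hf : (Set.pi Set.univ fun j => {s : Profile A O | s2g s = c j}).Finite :=
      Set.Finite.pi' ih |>.subset (by intro x hx j; exact hx j trivial)
    refine ((hf.prod (Set.finite_univ (α := Fin (n+1)))).image
      (fun x => node p n x.1 x.2)).subset ?_
    intro s h
    cases s with
    | leaf => simp [s2g] at h
    | node p' n' c' i' =>
      simp only [s2g, GameTree.node.injEq, Set.mem_ofPred_eq] at h
      obtain ⟨rfl, rfl, h⟩ := h
      have h := eq_of_heq h
      exact ⟨(c', i'), ⟨fun j _ => congrFun h j, trivial⟩, rfl⟩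

theorem lazy_term {A O : Type} (prec : A → O → O → Prop) (hac : ∀ a : A, Acyclic (prec a))
    (f : ℕ → Profile A O) (hf : ∀ n, Lazy prec (f n) (f (n+1))) : False := by
  classical
  have hg : ∀ n, s2g (f n) = s2g (f 0) := by
    intro n
    induction n with
    | zero => rfl
    | succ n ih => obtain ⟨a, h, _⟩ := hf n; rw [h.s2g_eq, ih]
  let X := {s : Profile A O // s2g s = s2g (f 0)}
  have : Finite X := finite_s2g (s2g (f 0))
  have hB : ∀ s s', ∃ a, Lazy prec s s' → LazyImp prec a s s' := by
    intro s s'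
    by_cases h : Lazy prec s s'
    · obtain ⟨a, h⟩ := h; exact ⟨a, fun _ => h⟩
    · obtain ⟨a, _⟩ := hf 0; exact ⟨a, fun h' => absurd h' h⟩
  choose B hB using hB
  let F : ℕ → X := fun n => ⟨f n, hg n⟩
  let b : ℕ → A := fun n => B (f n) (f (n+1))
  have hb : ∀ n, LazyImp prec (b n) (f n) (f (n+1)) := fun n => hB _ _ (hf n)
  have pigeon : ∀ {Y : Type} [Finite Y] (P : ℕ → Prop) (G : ℕ → Y),
      (∃ᶠ n in Filter.atTop, P n) → ∃ y, ∃ᶠ n in Filter.atTop, P n ∧ G n = y := by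
    intro Y _ P G h
    by_contra hc
    push Not at hc
    have := Filter.eventually_all.2 hc
    refine h (this.mono fun n hn hP => ?_)
    exact hn (G n) hP rfl
  obtain ⟨⟨s1, s2⟩, h12⟩ := pigeon (fun _ => True) (fun n => (F n, F (n+1)))
    (Filter.Frequently.of_forall fun _ => trivial)
  obtain ⟨a, ha⟩ : ∃ a, a = B s1.1 s2.1 := ⟨_, rfl⟩
  have hX1 : ∃ᶠ n in Filter.atTop, b n = a ∧ F n = s1 := by
    refine h12.mono fun n hn => ?_
    have e := hn.2
    simp only [Prod.mk.injEq] at e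
    refine ⟨?_, e.1⟩
    rw [ha, ← e.1, ← e.2]
  let r : X → X → Prop := fun x y => Relation.TransGen (prec a) x.1.outcome y.1.outcome
  have : IsTrans X r := ⟨fun _ _ _ h h' => Relation.TransGen.trans h h'⟩
  have : Std.Irrefl r := ⟨fun x h => hac a _ h⟩
  have wf : WellFounded r := Finite.wellFounded_of_trans_of_irrefl r
  obtain ⟨s, hs, hmin⟩ := wf.has_min {x | ∃ᶠ n in Filter.atTop, b n = a ∧ F n = x} ⟨s1, hX1⟩
  have key : ∃ᶠ k in Filter.atTop, b k = a ∧ prec a (f k).outcome s.1.outcome := by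
    replace hs : ∃ᶠ n in Filter.atTop, b n = a ∧ F n = s := hs
    rw [Filter.frequently_atTop] at hs ⊢
    intro N
    obtain ⟨n, hn, hbn, hFn⟩ := hs N
    obtain ⟨m, hm, -, hFm⟩ := hs (n+1)
    have hfn : f n = s.1 := congrArg Subtype.val hFn
    have hfm : f m = s.1 := congrArg Subtype.val hFm
    by_contra hc
    push Not at hc
    have inv : ∀ k, n + 1 ≤ k → dev (f k) (play s.1) = some a := by
      intro k hk
      induction k, hk using Nat.le_induction with
      | base =>
        have h0 : dev (f n) (play s.1) = none := by rw [hfn]; exact dev_self _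
        have hne : dev (f (n+1)) (play s.1) ≠ none := by
          intro h
          have := dev_none s.1 _ ((hg (n+1)).trans s.2.symm) h
          have h2 := (hb n).2
          rw [this, hfn] at h2
          exact hac _ _ (.single h2)
        rcases dev_step_s5 (hb n).1 (play s.1) with h | h | h
        · rw [h0] at h; exact absurd h hne
        · rw [h.2, hbn]
        · exact absurd h.2 hne
      | succ k hk ih =>
        rcases dev_step_s5 (hb k).1 (play s.1) with h | h | h
        · rw [h, ih]
        · rw [ih] at h; simp at h
        · exfalso
          have hba : b k = a := by
            have := h.1; rw [ih] at this; exact (Option.some.inj this).symm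
          have ho := dev_none s.1 _ ((hg (k+1)).trans s.2.symm) h.2
          have h2 := (hb k).2
          rw [hba, ho] at h2
          exact hc k (by omega) hba h2
    have := inv m hm
    rw [hfm, dev_self] at this
    simp at this
  obtain ⟨y, hy⟩ := pigeon _ F key
  have hy' : ∃ᶠ n in Filter.atTop, b n = a ∧ F n = y := hy.mono fun n hn => ⟨hn.1.1, hn.2⟩
  obtain ⟨k, ⟨_, hk⟩, hFk⟩ := hy.exists
  refine hmin y hy' (.single ?_)
  rw [← hFk]; exact hk

theorem chain_of_transGen {O : Type} {r : O → O → Prop} {x y : O} (h : Relation.TransGen r x y) :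
    ∃ (n : ℕ) (c : ℕ → O), c 0 = x ∧ c (n+1) = y ∧ ∀ i ≤ n, r (c i) (c (i+1)) := by
  induction h with
  | @single y h =>
    refine ⟨0, fun i => if i = 0 then x else y, by simp, by simp, ?_⟩
    intro i hi
    obtain rfl : i = 0 := by omega
    simpa using h
  | @tail y z _ h ih =>
    obtain ⟨n, c, h0, h1, hc⟩ := ih
    refine ⟨n+1, fun i => if i ≤ n + 1 then c i else z, by simp [h0], by simp, ?_⟩
    intro i hi
    by_cases e : i = n + 1
    · subst e; simpa [h1] using h
    · have : i ≤ n := by omega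
      simpa [this, hi] using hc i this

end Profile

open Profile in
/-- Fix outcomes `O`, players `A` and preferences `(≺_a)`. All preferences are acyclic
iff for every finite sequential game built from them (i.e. for every strategy profile of
such a game) the collective lazy improvement `⇀` terminates: there is no infinite
sequence `s₀ ⇀ s₁ ⇀ s₂ ⇀ …`. -/
theorem all_acyclic_iff_lazy_terminates {A O : Type} [Nonempty A] [Nonempty O]
    (prec : A → O → O → Prop) :
    (∀ a : A, Acyclic (prec a))
      ↔ ¬ ∃ f : ℕ → Profile A O, ∀ n : ℕ, Lazy prec (f n) (f (n+1)) := by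
  refine ⟨fun h ⟨f, hf⟩ => lazy_term prec h f hf, ?_⟩
  intro h a x hx
  obtain ⟨n, c, h0, h1, hc⟩ := chain_of_transGen hx
  refine h ⟨fun k => .node a n (fun j => .leaf (c j.1)) ⟨k % (n+1), Nat.mod_lt _ (by omega)⟩, ?_⟩
  intro k
  refine ⟨a, .node _ _ _ _ _ _ (fun _ => rfl) (fun _ _ => rfl) (.leaf _), ?_⟩
  simp only [outcome]
  have hlt : k % (n+1) < n + 1 := Nat.mod_lt _ (by omega)
  have := hc (k % (n+1)) (by omega)
  by_cases e : k % (n+1) = n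
  · have e2 : (k+1) % (n+1) = 0 := by
      rw [Nat.add_mod, e]
      rcases n with _ | n
      · simp
      · rw [Nat.mod_eq_of_lt (a := 1) (by omega)]; simp
    rw [e2, h0, ← h1, e]
    rwa [e] at this
  · have e2 : (k+1) % (n+1) = k % (n+1) + 1 := by
      rw [← Nat.mod_add_mod]
      exact Nat.mod_eq_of_lt (by omega)
    rw [e2]; exact this
end

section
/- In a finite sequential game, if player a lazily converts s to s' (s ⇀ᶜ_a s') and b is a player with b ≠ a, then δ(s, b, o) = δ(s', b, o) for every outcome o. -/
/-- Number of leaves of a finite game tree. -/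
def GameTree.leaves {A O : Type} : GameTree A O → ℕ
  | .leaf _ => 1
  | .node _ _ c => ∑ j, (c j).leaves

/-- The avoided outcomes of a game `Δ(g,a)`: at each vertex owned by `a` with `n+1`
children, add `n`. -/
def GameTree.Delta {A O : Type} [DecidableEq A] : GameTree A O → A → ℕ
  | .leaf _, _ => 0
  | .node p n c, a => (∑ j, (c j).Delta a) + (if p = a then n else 0)

/-- The avoided outcomes of a profile `δ(s,a,o)`: at each vertex owned by `a` with
chosen child `i`, count the non-chosen children whose subprofiles induce outcome `o`. -/
def Profile.delta {A O : Type} [DecidableEq A] [DecidableEq O] : Profile A O → A → O → ℕ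
  | .leaf _, _, _ => 0
  | .node p _ c i, a, o =>
      (∑ j, (c j).delta a o) +
      (if p = a then (Finset.univ.filter fun j => j ≠ i ∧ (c j).outcome = o).card else 0)

open Profile in
/-- If player `a` lazily converts `s` to `s'` and `b ≠ a`, then the avoided outcomes of
player `b` are conserved: `δ(s, b, o) = δ(s', b, o)` for every outcome `o`. -/
theorem delta_eq_of_lazyConv_of_ne {A O : Type} [DecidableEq A] [DecidableEq O]
    (a b : A) (s s' : Profile A O)
    (h : LazyConv a s s') (hne : b ≠ a) (o : O) :
    s.delta b o = s'.delta b o := by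
  induction h with
  | leaf o => rfl
  | node p n c c' i i' hi hc _ ih =>
    simp only [Profile.delta]
    congr 1
    · apply Finset.sum_congr rfl
      intro j _
      by_cases hj : j = i'
      · subst hj
        exact ih
      · rw [hc j hj]
    · by_cases hp : p = b
      · have hii : i = i' := by
          by_contra hcon
          exact hne (hp.symm.trans (hi hcon))
        subst hii
        rw [if_pos hp, if_pos hp]
        congr 1
        apply Finset.filter_congr
        intro j _
        constructor
        · rintro ⟨h1, h2⟩
          exact ⟨h1, by rw [← hc j h1]; exact h2⟩
        · rintro ⟨h1, h2⟩
          exact ⟨h1, by rw [hc j h1]; exact h2⟩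
      · rw [if_neg hp, if_neg hp]
end

section
/- In a finite sequential game, if player a lazily converts s to s' (s ⇀ᶜ_a s'), then for every outcome o it holds that δ(s, a, o) + eq(v(s), o) = δ(s', a, o) + eq(v(s'), o), where eq(x,y) = 1 if x = y and 0 otherwise. -/
theorem card_aux {O : Type} [DecidableEq O] {n : ℕ} (f : Fin (n+1) → O) (i : Fin (n+1)) (o : O) :
    (Finset.univ.filter fun j => j ≠ i ∧ f j = o).card + (if f i = o then 1 else 0)
      = ∑ j, (if f j = o then 1 else 0) := by
  rw [← Finset.sum_erase_add _ _ (Finset.mem_univ i), Finset.sum_boole]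
  congr 1
  simp only [Nat.cast_id]
  congr 1
  ext j
  simp

open Profile in
/-- If player `a` lazily converts `s` to `s'`, then for every outcome `o`,
`δ(s, a, o) + eq(v(s), o) = δ(s', a, o) + eq(v(s'), o)`, where `eq(x,y)` is `1` if
`x = y` and `0` otherwise. -/
theorem delta_add_eq_of_lazyConv {A O : Type} [DecidableEq A] [DecidableEq O]
    (a : A) (s s' : Profile A O)
    (h : LazyConv a s s') (o : O) :
    s.delta a o + (if s.outcome = o then 1 else 0)
      = s'.delta a o + (if s'.outcome = o then 1 else 0) := by
  induction h with
  | leaf o' => rfl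
  | node p n c c' i i' hp hc _ ih =>
    change (node p n c i).delta a o + (if (c i).outcome = o then 1 else 0)
      = (node p n c' i').delta a o + (if (c' i').outcome = o then 1 else 0)
    simp only [Profile.delta]
    by_cases hpa : p = a
    · simp only [hpa, if_true]
      rw [add_assoc, add_assoc, card_aux (fun j => (c j).outcome) i o,
        card_aux (fun j => (c' j).outcome) i' o, ← Finset.sum_add_distrib,
        ← Finset.sum_add_distrib]
      refine Finset.sum_congr rfl fun j _ => ?_
      by_cases hj : j = i'
      · subst hj; exact ih
      · rw [hc j hj]
    · have hi : i = i' := by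
        by_contra hne
        exact hpa (hp hne)
      subst hi
      simp only [hpa, if_false]
      rw [← Finset.sum_erase_add _ _ (Finset.mem_univ i),
        ← Finset.sum_erase_add _ (fun j => (c' j).delta a o) (Finset.mem_univ i)]
      have : ∑ j ∈ Finset.univ.erase i, (c j).delta a o
          = ∑ j ∈ Finset.univ.erase i, (c' j).delta a o :=
        Finset.sum_congr rfl fun j hj => by rw [hc j (Finset.ne_of_mem_erase hj)]
      omega
end

section
/- Consider a finite sequential game g in which player a has an acyclic preference relation of height at most h (no chain x₁ ≺_a x₂ ≺_a … ≺_a x_{h+1}), and let Δ(g,a) be the total number of choices available to player a minus the number of vertices where a chooses. Then in any (possibly infinite) sequence of lazy improvement steps, the number of steps performed by player a (i.e. indices n with s_n ⇀_a s_{n+1}) is at most (h − 1)·Δ(g,a). -/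
def Profile.Phi {A O : Type} [DecidableEq A] (r : O → ℕ) (a : A) : Profile A O → ℕ
  | .leaf _ => 0
  | .node p _ c i => (∑ j, (c j).Phi r a) +
      (if p = a then ∑ j ∈ Finset.univ.erase i, r (c j).outcome else 0)

theorem Profile.Phi_self {A O : Type} [DecidableEq A] (r : O → ℕ) (a : A)
    {s s' : Profile A O} (hc : LazyConv a s s') :
    s.Phi r a + r s.outcome = s'.Phi r a + r s'.outcome := by
  induction hc with
  | leaf o => rfl
  | node p n c c' i i' hp hne _ ih =>
    simp only [Phi, outcome]
    by_cases hpa : p = a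
    · simp only [hpa, if_true]
      rw [add_assoc, add_assoc, Finset.sum_erase_add _ _ (Finset.mem_univ i),
        Finset.sum_erase_add _ _ (Finset.mem_univ i'), ← Finset.sum_add_distrib,
        ← Finset.sum_add_distrib]
      refine Finset.sum_congr rfl fun j _ => ?_
      by_cases hj : j = i'
      · rw [hj]; exact ih
      · rw [hne j hj]
    · have hi : i = i' := by
        by_contra hne'
        exact hpa (hp hne')
      subst hi
      simp only [hpa, if_false, add_zero]
      rw [← Finset.sum_erase_add _ _ (Finset.mem_univ i),
        ← Finset.sum_erase_add (a := i) _ (fun j => (c' j).Phi r a) (Finset.mem_univ i),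
        add_assoc, add_assoc, ih]
      congr 1
      refine Finset.sum_congr rfl fun j hj => ?_
      rw [hne j (Finset.ne_of_mem_erase hj)]

theorem Profile.Phi_other {A O : Type} [DecidableEq A] (r : O → ℕ) (a b : A) (hab : b ≠ a)
    {s s' : Profile A O} (hc : LazyConv b s s') :
    s.Phi r a = s'.Phi r a := by
  induction hc with
  | leaf o => rfl
  | node p n c c' i i' hp hne _ ih =>
    simp only [Phi]
    congr 1
    · refine Finset.sum_congr rfl fun j _ => ?_
      by_cases hj : j = i'
      · rw [hj]; exact ih
      · rw [hne j hj]
    · by_cases hpa : p = a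
      · have hi : i = i' := by
          by_contra hne'
          exact hab ((hp hne').symm.trans hpa)
        subst hi
        simp only [hpa, if_true]
        refine Finset.sum_congr rfl fun j hj => ?_
        rw [hne j (Finset.ne_of_mem_erase hj)]
      · simp [hpa]

theorem Profile.Phi_le {A O : Type} [DecidableEq A] (r : O → ℕ) (a : A) (k : ℕ)
    (hr : ∀ o, r o ≤ k) (s : Profile A O) : s.Phi r a ≤ k * (s2g s).Delta a := by
  induction s with
  | leaf o => simp [Phi]
  | node p n c i ih =>
    simp only [Phi, s2g, GameTree.Delta, mul_add, Finset.mul_sum]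
    refine add_le_add (Finset.sum_le_sum fun j _ => ih j) ?_
    split_ifs
    · refine (Finset.sum_le_card_nsmul _ _ k fun j _ => hr _).trans ?_
      simp [mul_comm]
    · simp

theorem exists_rank {O : Type} (R : O → O → Prop) (h : ℕ) (o₀ : O)
    (hh : ¬ ∃ x : ℕ → O, ∀ i, i < h → R (x i) (x (i+1))) :
    ∃ r : O → ℕ, (∀ o, r o ≤ h - 1) ∧ ∀ x y, R x y → r x < r y := by
  classical
  have hpos : 0 < h := by
    rcases Nat.eq_zero_or_pos h with rfl | h0
    · exact absurd ⟨fun _ => o₀, fun i hi => absurd hi (Nat.not_lt_zero i)⟩ hh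
    · exact h0
  let P : O → ℕ → Prop := fun o n => ∃ x : ℕ → O, x n = o ∧ ∀ i, i < n → R (x i) (x (i+1))
  refine ⟨fun o => Nat.findGreatest (P o) (h - 1), fun o => Nat.findGreatest_le _, ?_⟩
  intro u v huv
  have h0 : P u 0 := ⟨fun _ => u, rfl, fun i hi => absurd hi (Nat.not_lt_zero i)⟩
  have hP : P u (Nat.findGreatest (P u) (h - 1)) := Nat.findGreatest_spec (Nat.zero_le _) h0
  have hle : Nat.findGreatest (P u) (h - 1) ≤ h - 1 := Nat.findGreatest_le _
  show Nat.findGreatest (P u) (h - 1) < Nat.findGreatest (P v) (h - 1)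
  generalize Nat.findGreatest (P u) (h - 1) = m at hP hle
  obtain ⟨x, hx, hR⟩ := hP
  have hchain : ∀ i, i < m + 1 → R ((fun i => if i ≤ m then x i else v) i)
      ((fun i => if i ≤ m then x i else v) (i+1)) := by
    intro i hi
    rcases Nat.lt_or_ge i m with hlt | hge
    · have h1 : i ≤ m := hlt.le
      have h2 : i + 1 ≤ m := hlt
      simpa [h1, h2] using hR i hlt
    · have : i = m := by omega
      subst this
      simpa [hx] using huv
  have hm : m + 1 ≤ h - 1 := by
    by_contra hcon
    have : m + 1 = h := by omega
    exact hh ⟨_, this ▸ hchain⟩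
  exact Nat.le_findGreatest hm ⟨_, by simp, hchain⟩

open Profile GameTree Classical in
/-- If player `a` has an acyclic preference relation of height at most `h` (no chain of
`h+1` elements `x₁ ≺_a … ≺_a x_{h+1}`), then in any (possibly infinite) sequence
`s₀ ⇀ s₁ ⇀ …` of lazy improvement steps, the number of steps performed by player `a` is
at most `(h - 1) · Δ(g, a)`, where `g` is the underlying game. -/
theorem lazy_steps_of_player_le {A O : Type} [DecidableEq A] [DecidableEq O]
    (prec : A → O → O → Prop) (a : A) (h : ℕ)
    (hacyc : Acyclic (prec a))
    (hheight : ¬ ∃ x : ℕ → O, ∀ i, i < h → prec a (x i) (x (i+1)))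
    (f : ℕ → Profile A O) (N : ℕ)
    (hstep : ∀ n, n < N → Lazy prec (f n) (f (n+1))) :
    ((Finset.range N).filter fun n => LazyImp prec a (f n) (f (n+1))).card
      ≤ (h - 1) * (s2g (f 0)).Delta a := by
  obtain ⟨r, hr, hlt⟩ := exists_rank (prec a) h (f 0).outcome hheight
  refine le_trans ?_ (Phi_le r a (h - 1) hr (f 0))
  suffices H : ∀ M, M ≤ N →
      ((Finset.range M).filter fun n => LazyImp prec a (f n) (f (n+1))).card
        + (f M).Phi r a ≤ (f 0).Phi r a by
    exact (Nat.le_add_right _ _).trans (H N le_rfl)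
  intro M
  induction M with
  | zero => intro _; simp
  | succ M ih =>
    intro hM
    have ih' := ih (by omega)
    rw [Finset.range_add_one, Finset.filter_insert]
    split_ifs with hc
    · rw [Finset.card_insert_of_notMem (by simp)]
      have h1 := Phi_self r a hc.1
      have h2 := hlt _ _ hc.2
      omega
    · obtain ⟨b, hb⟩ := hstep M (by omega)
      have hba : b ≠ a := by
        rintro rfl
        exact hc hb
      have h1 := Phi_other r a b hba hb.1
      omega
end

section
/- In a finite sequential game in which every player's preference relation is acyclic and admits no strictly increasing chain of more than h elements, every sequence of lazy improvement steps s₀ ⇀ s₁ ⇀ … has length at most (h − 1)·(l − 1), where l is the number of leaves of the game tree. In particular lazy improvement terminates. -/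
open Classical in
theorem exists_rank_aux {O : Type} (r : O → O → Prop) (h : ℕ)
    (hh : ¬ ∃ x : ℕ → O, ∀ i, i < h → r (x i) (x (i+1))) :
    ∃ k : O → ℕ, (∀ o, k o ≤ h - 1) ∧ ∀ x y, r x y → k x < k y := by
  let P : O → ℕ → Prop := fun o k => ∃ x : ℕ → O, x k = o ∧ ∀ i, i < k → r (x i) (x (i+1))
  have hlt : ∀ o k, P o k → k < h := by
    rintro o k ⟨x, -, hx⟩
    by_contra hk
    exact hh ⟨x, fun i hi => hx i (by omega)⟩
  refine ⟨fun o => Nat.findGreatest (P o) (h - 1), fun o => Nat.findGreatest_le _, ?_⟩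
  intro a b hab
  change Nat.findGreatest (P a) (h - 1) < Nat.findGreatest (P b) (h - 1)
  have h0 : P a 0 := ⟨fun _ => a, rfl, by intro i hi; omega⟩
  have h1 : P a (Nat.findGreatest (P a) (h - 1)) :=
    Nat.findGreatest_spec (Nat.zero_le _) h0
  obtain ⟨x, hx, hr⟩ := h1
  generalize Nat.findGreatest (P a) (h - 1) = m at hx hr ⊢
  have h2 : P b (m + 1) := by
    refine ⟨fun i => if i ≤ m then x i else b, by simp, ?_⟩
    intro i hi
    rcases Nat.lt_or_ge i m with him | him
    · have e1 : i ≤ m := by omega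
      have e2 : i + 1 ≤ m := by omega
      simpa [e1, e2] using hr i him
    · have e : i = m := by omega
      subst e
      simpa [hx] using hab
  have h3 := hlt b _ h2
  have h4 : m + 1 ≤ Nat.findGreatest (P b) (h - 1) :=
    Nat.le_findGreatest (by omega) h2
  exact h4

/-- Weighted sum of avoided outcomes. -/
def Profile.phi {A O : Type} (r : A → O → ℕ) : Profile A O → ℕ
  | .leaf _ => 0
  | .node p _ c i => (∑ j, (c j).phi r) + ∑ j ∈ Finset.univ.erase i, r p (c j).outcome

theorem Profile.phi_conv {A O : Type} (r : A → O → ℕ) (a : A) (s s' : Profile A O)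
    (hc : Profile.LazyConv a s s') :
    s'.phi r + r a s'.outcome = s.phi r + r a s.outcome := by
  induction hc with
  | leaf o => rfl
  | node p n c c' i i' hp hj _ ih =>
    simp only [Profile.phi, Profile.outcome]
    by_cases hpa : p = a
    · subst hpa
      rw [add_assoc, add_assoc, Finset.sum_erase_add _ _ (Finset.mem_univ _),
        Finset.sum_erase_add _ _ (Finset.mem_univ _), ← Finset.sum_add_distrib,
        ← Finset.sum_add_distrib]
      refine Finset.sum_congr rfl fun j _ => ?_
      by_cases hji : j = i'
      · subst hji; exact ih
      · rw [hj j hji]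
    · have hi : i = i' := by
        by_contra hne
        exact hpa (hp hne)
      subst hi
      have e1 : ∑ j ∈ Finset.univ.erase i, r p (c' j).outcome
          = ∑ j ∈ Finset.univ.erase i, r p (c j).outcome :=
        Finset.sum_congr rfl fun j hm => by rw [hj j (Finset.ne_of_mem_erase hm)]
      have e2 : ∑ j ∈ Finset.univ.erase i, (c' j).phi r
          = ∑ j ∈ Finset.univ.erase i, (c j).phi r :=
        Finset.sum_congr rfl fun j hm => by rw [hj j (Finset.ne_of_mem_erase hm)]
      rw [← Finset.sum_erase_add _ _ (Finset.mem_univ i),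
        ← Finset.sum_erase_add _ (fun j => (c j).phi r) (Finset.mem_univ i), e1, e2]
      omega

theorem Profile.phi_le {A O : Type} (r : A → O → ℕ) (m : ℕ) (hr : ∀ a o, r a o ≤ m)
    (s : Profile A O) : s.phi r + m ≤ m * (s.s2g).leaves := by
  induction s with
  | leaf o => simp [Profile.phi, Profile.s2g, GameTree.leaves]
  | node p n c i ih =>
    simp only [Profile.phi, Profile.s2g, GameTree.leaves]
    rw [Finset.mul_sum]
    have h1 := Finset.sum_le_sum (fun j (_ : j ∈ Finset.univ) => ih j)
    have h2 : ∑ j ∈ Finset.univ.erase i, r p (c j).outcome + m ≤ ∑ _j : Fin (n+1), m := by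
      rw [← Finset.sum_erase_add _ _ (Finset.mem_univ i)]
      exact Nat.add_le_add_right (Finset.sum_le_sum fun j _ => hr _ _) _
    rw [Finset.sum_add_distrib] at h1
    omega

open Profile GameTree in
/-- If every player's preference relation is acyclic and admits no strictly increasing
chain of more than `h` elements, then every sequence of lazy improvement steps
`s₀ ⇀ s₁ ⇀ …` has length at most `(h - 1)·(l - 1)`, where `l` is the number of leaves of
the game tree; in particular lazy improvement terminates. -/
theorem lazy_improvement_length_le {A O : Type}
    (prec : A → O → O → Prop) (h : ℕ)
    (hacyc : ∀ a : A, Acyclic (prec a))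
    (hheight : ∀ a : A, ¬ ∃ x : ℕ → O, ∀ i, i < h → prec a (x i) (x (i+1))) :
    (∀ (f : ℕ → Profile A O) (N : ℕ), (∀ n, n < N → Lazy prec (f n) (f (n+1))) →
        N ≤ (h - 1) * ((s2g (f 0)).leaves - 1))
    ∧ ¬ ∃ f : ℕ → Profile A O, ∀ n : ℕ, Lazy prec (f n) (f (n+1)) := by
  choose r hr hlt using fun a => exists_rank_aux (prec a) h (hheight a)
  have main : ∀ (f : ℕ → Profile A O) (N : ℕ), (∀ n, n < N → Lazy prec (f n) (f (n+1))) →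
      N ≤ (h - 1) * ((s2g (f 0)).leaves - 1) := by
    intro f N hN
    have key : ∀ n, n ≤ N → (f n).phi r + n ≤ (f 0).phi r := by
      intro n
      induction n with
      | zero => intro _; simp
      | succ n ih =>
        intro hn
        have h1 := ih (by omega)
        obtain ⟨a, hc, hp⟩ := hN n (by omega)
        have h2 := Profile.phi_conv r a _ _ hc
        have h3 := hlt a _ _ hp
        omega
    have h1 := key N le_rfl
    have h2 := Profile.phi_le r (h - 1) hr (f 0)
    rw [Nat.mul_sub, mul_one]
    omega
  refine ⟨main, ?_⟩
  rintro ⟨f, hf⟩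
  have := main f ((h - 1) * ((s2g (f 0)).leaves - 1) + 1) (fun n _ => hf n)
  omega
end

section
/- The quadratic bound on lazy improvement is tight: for every n ∈ ℕ there exists a finite two-player sequential game with n+2 leaves in each relevant branch (a root owned by player a with n+1 subtrees, each a node owned by player b with two leaves) together with acyclic linear preferences and an initial strategy profile from which there is a sequence of lazy improvement steps of length (n+2)(n+3)/2 − 2. -/
/-- Rank of an outcome for player `a` in the tightness game: `y = none` has rank `0`,
and `x_i = some i` has rank `i + 1`, so that `y ≺_a x₀ ≺_a x₁ ≺_a … ≺_a x_n`. -/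
def rankA {n : ℕ} : Option (Fin (n+1)) → ℕ
  | none => 0
  | some i => i.1 + 1

/-- Preferences of the tightness game on outcomes `y = none` and `x_i = some i`:
player `0` (player `a`) has `y ≺_a x₀ ≺_a … ≺_a x_n`, and player `1` (player `b`) has
`x_i ≺_b y` for all `i`. These are acyclic linear preferences. -/
def tightPrec (n : ℕ) (p : Fin 2) (u v : Option (Fin (n+1))) : Prop :=
  if p = 0 then rankA u < rankA v else (u ≠ none ∧ v = none)

/-- The tightness game with its initial strategy profile: the root is owned by player
`0` (player `a`) and has `n+1` children, the `i`-th of which is owned by player `1`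
(player `b`) and has the two leaves `x_i` (chosen initially) and `y`; the root initially
points to its `0`-th child. -/
def tightGame (n : ℕ) : Profile (Fin 2) (Option (Fin (n+1))) :=
  .node 0 n
    (fun i => .node 1 1 (fun j => if j = 0 then .leaf (some i) else .leaf none) 0) 0

namespace TightAux

/-- Subtree number `i`, with choice `c`. -/
def sub (n : ℕ) (i : Fin (n+1)) (c : Fin 2) : Profile (Fin 2) (Option (Fin (n+1))) :=
  .node 1 1 (fun j => if j = 0 then .leaf (some i) else .leaf none) c

/-- Profile where the children below `t` choose left, the others right, and the root chooses `i`. -/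
def st (n t : ℕ) (i : Fin (n+1)) : Profile (Fin 2) (Option (Fin (n+1))) :=
  .node 0 n (fun j => sub n j (if j.1 < t then 0 else 1)) i

def Ch {X : Type} (r : X → X → Prop) (N : ℕ) (s : X) : Prop :=
  ∃ f : ℕ → X, f 0 = s ∧ ∀ k, k < N → r (f k) (f (k+1))

theorem Ch.zero {X : Type} (r : X → X → Prop) (s : X) : Ch r 0 s :=
  ⟨fun _ => s, rfl, fun k hk => absurd hk (Nat.not_lt_zero k)⟩

theorem Ch.step {X : Type} {r : X → X → Prop} {N : ℕ} {s s' : X} (h : r s s')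
    (hc : Ch r N s') : Ch r (N+1) s := by
  obtain ⟨f, h0, hf⟩ := hc
  refine ⟨fun k => Nat.casesOn k s f, rfl, ?_⟩
  intro k hk
  cases k with
  | zero => show r s (f 0); rw [h0]; exact h
  | succ k => exact hf k (by omega)

theorem outcome_st (n t : ℕ) (i : Fin (n+1)) :
    (st n t i).outcome = if i.1 < t then some i else none := by
  by_cases h : i.1 < t <;> simp [st, sub, Profile.outcome, h]

theorem conv_refl (a : Fin 2) (n : ℕ) (i : Fin (n+1)) (c : Fin 2) :
    Profile.LazyConv a (sub n i c) (sub n i c) := by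
  refine .node _ _ _ _ _ _ (fun h => absurd rfl h) (fun _ _ => rfl) ?_
  by_cases h : c = 0 <;> simp only [h, if_true, if_false] <;> exact .leaf _

theorem moveA (n t : ℕ) (i i' : Fin (n+1)) (h' : i'.1 < t) (h : i.1 < t → i.1 < i'.1) :
    Profile.Lazy (tightPrec n) (st n t i) (st n t i') := by
  refine ⟨0, .node _ _ _ _ _ _ (fun _ => rfl) (fun _ _ => rfl) (conv_refl _ _ _ _), ?_⟩
  rw [outcome_st, outcome_st]
  by_cases hi : i.1 < t
  · have := h hi
    simp [tightPrec, hi, h', rankA, this]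
  · simp [tightPrec, hi, h', rankA]

theorem moveB (n : ℕ) (i : Fin (n+1)) :
    Profile.Lazy (tightPrec n) (st n (i.1+1) i) (st n i.1 i) := by
  refine ⟨1, .node _ _ _ _ _ _ (fun h => absurd rfl h) ?_ ?_, ?_⟩
  · intro j hj
    have hj' : j.1 ≠ i.1 := fun h => hj (Fin.ext h)
    have : (j.1 < i.1 + 1) ↔ (j.1 < i.1) := by omega
    simp only [this]
  · refine .node _ _ _ _ _ _ (fun _ => rfl) (fun _ _ => rfl) ?_
    simp only [lt_irrefl, if_false]
    exact .leaf _
  · rw [outcome_st, outcome_st]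
    simp [tightPrec]

def len : ℕ → ℕ
  | 0 => 1
  | m+1 => len m + 1 + 1 + (m+1)

theorem len_eq (m : ℕ) : 2 * len m + 4 = (m+2)*(m+3) := by
  induction m with
  | zero => rfl
  | succ m ih => simp only [len]; nlinarith

theorem up (n m N : ℕ) (hm : m < n+1)
    (hc : Ch (Profile.Lazy (tightPrec n)) N (st n (m+1) ⟨m, hm⟩)) (d : ℕ) (i : ℕ)
    (hi : i + d = m) :
    Ch (Profile.Lazy (tightPrec n)) (N + d) (st n (m+1) ⟨i, by omega⟩) := by
  induction d generalizing i with
  | zero => obtain rfl : i = m := by omega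
            exact hc
  | succ d ih =>
    exact Ch.step (moveA n (m+1) _ ⟨i+1, by omega⟩ (by simp; omega) (by simp))
      (ih (i+1) (by omega))

theorem main (n m : ℕ) (hm : m < n+1) :
    Ch (Profile.Lazy (tightPrec n)) (len m) (st n (m+1) ⟨0, by omega⟩) := by
  induction m with
  | zero => exact Ch.step (moveB n ⟨0, hm⟩) (Ch.zero _ _)
  | succ m ih =>
    refine up n (m+1) _ hm ?_ (m+1) 0 (by omega)
    exact Ch.step (moveB n ⟨m+1, hm⟩)
      (Ch.step (moveA n (m+1) _ ⟨0, by omega⟩ (by simp) (by simp)) (ih (by omega)))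

theorem acyc (n : ℕ) (p : Fin 2) : Acyclic (tightPrec n p) := by
  intro x hx
  by_cases hp : p = 0
  · have key : ∀ y, Relation.TransGen (tightPrec n p) x y → rankA x < rankA y := by
      intro y hy
      induction hy with
      | single h => simpa [tightPrec, hp] using h
      | tail _ h ih =>
        have h2 := h
        simp only [tightPrec, hp, if_true] at h2
        omega
    exact lt_irrefl _ (key x hx)
  · have key : ∀ y, Relation.TransGen (tightPrec n p) x y → x ≠ none ∧ y = none := by
      intro y hy
      induction hy with
      | single h => simpa [tightPrec, hp] using h
      | tail _ h ih =>
        have h2 := h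
        simp only [tightPrec, hp, if_false] at h2
        exact ⟨ih.1, h2.2⟩
    exact (key x hx).1 (key x hx).2

end TightAux

open Profile in
/-- Tightness of the quadratic bound on lazy improvement: for every `n` there is a finite
two-player sequential game — a root owned by player `a` with `n+1` subtrees, each a node
owned by player `b` with two leaves — with acyclic linear preferences and an initial
strategy profile from which some sequence of lazy improvement steps has length
`(n+2)(n+3)/2 − 2`. -/
theorem lazy_quadratic_bound_tight (n : ℕ) :
    (∀ p : Fin 2, Acyclic (tightPrec n p)) ∧
    ∃ f : ℕ → Profile (Fin 2) (Option (Fin (n+1))),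
      f 0 = tightGame n ∧
      ∀ k, k < (n+2) * (n+3) / 2 - 2 → Lazy (tightPrec n) (f k) (f (k+1)) := by
  refine ⟨TightAux.acyc n, ?_⟩
  have hl : (n+2) * (n+3) / 2 - 2 = TightAux.len n := by
    have := TightAux.len_eq n
    omega
  have hs : tightGame n = TightAux.st n (n+1) ⟨0, by omega⟩ := by
    simp only [tightGame, TightAux.st, TightAux.sub, Fin.is_lt, if_true]
    rfl
  rw [hl, hs]
  exact TightAux.main n n (by omega)
end
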